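/- (The curve PD₁^d of period-doubling points.) Fix d ∈ {−1, 1} and M₂ ∈ ℝ, and suppose y ∈ ℝ satisfies 3 d y² = −(2 + M₂). Set M₁ = (8 − 2M₂)·y/3. Then (y, y) is a fixed point of the cubic Hénon map H₃^d(x,y) = (y, −x + M₁ + M₂y + d y³), the Jacobian matrix of H₃^d at (y,y) has trace −2 and determinant 1 (so it has the double eigenvalue −1), and the parameters satisfy M₁² = −(4d/27)(2 + M₂)(4 − M₂)². -/

import Mathlib

/-- The cubic Hénon map `H₃^d(x,y) = (y, -x + M₁ + M₂·y + d·y³)`. -/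
def henonCubic (d M₁ M₂ : ℝ) : ℝ × ℝ → ℝ × ℝ :=
  fun p => (p.2, -p.1 + M₁ + M₂ * p.2 + d * p.2 ^ 3)

/-- the curve `PD₁^d` of period-doubling points: if
`3dy² = -(2 + M₂)` and `M₁ = (8 - 2M₂)y/3`, then `(y,y)` is a fixed point of
`H₃^d`, the Jacobian matrix of `H₃^d` at `(y,y)` (rows `(0,1)` and
`(-1, M₂ + 3dy²)`) has trace `-2` and determinant `1` (double eigenvalue `-1`),
and `M₁² = -(4d/27)(2 + M₂)(4 - M₂)²`. -/
theorem henonCubic_period_doubling_curve (d M₂ y : ℝ) (hd : d = -1 ∨ d = 1)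
    (hy : 3 * d * y ^ 2 = -(2 + M₂)) :
    let M₁ : ℝ := (8 - 2 * M₂) * y / 3
    let A : Matrix (Fin 2) (Fin 2) ℝ := !![0, 1; -1, M₂ + 3 * d * y ^ 2]
    henonCubic d M₁ M₂ (y, y) = (y, y) ∧
    Matrix.trace A = -2 ∧
    A.det = 1 ∧
    M₁ ^ 2 = -(4 * d / 27) * (2 + M₂) * (4 - M₂) ^ 2 := by
  have hd2 : d ^ 2 = 1 := by rcases hd with rfl | rfl <;> norm_num
  refine ⟨?_, ?_, ?_, ?_⟩
  · refine Prod.ext rfl ?_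
    simp only [henonCubic]
    linear_combination y / 3 * hy
  · rw [Matrix.trace_fin_two_of]
    linear_combination hy
  · rw [Matrix.det_fin_two_of]
    ring
  · linear_combination 4 * (4 - M₂) ^ 2 / 9 * (d / 3 * hy - y ^ 2 * hd2)
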